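/- arXiv:1710.01021 — 3 statements merged into one kernel-verified Lean document; each statement's English description precedes it below -/
import Mathlib

section
/- Let L/K be a finite extension of number fields. If ξ ∈ W_{O_K}(O_L) is a Witt vector whose set of coefficient values { ξ_a ∈ O_L : a ∈ I_K } is a finite set, then the orbit I_K·ξ := { ψ_a ξ ∈ W_{O_K}(O_L) : a ∈ I_K } under the shift operators is also a finite set. -/
open NumberField

noncomputable section

/-- The multiplicative monoid `I_K` of nonzero ideals of the ring of integers of `K`. -/
def IdealMonoid (K : Type) [Field K] [NumberField K] : Submonoid (Ideal (𝓞 K)) where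
  carrier := {I | I ≠ ⊥}
  mul_mem' := by
    intro a b ha hb h
    rcases Ideal.mul_eq_bot.mp h with h' | h'
    · exact ha h'
    · exact hb h'
  one_mem' := by
    simp only [Set.mem_setOf_eq, Ideal.one_eq_top]
    exact top_ne_bot

/-- `I_K`, the monoid of nonzero ideals, as a type. -/
abbrev IK (K : Type) [Field K] [NumberField K] := ↥(IdealMonoid K)

/-- `P_K`, the set of nonzero prime ideals of `𝓞 K`, as a type. -/
def PrimeIdeal (K : Type) [Field K] [NumberField K] :=
  {p : Ideal (𝓞 K) // p.IsPrime ∧ p ≠ ⊥}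

/-- A nonzero prime ideal, regarded as an element of `I_K`. -/
def PrimeIdeal.toIK {K : Type} [Field K] [NumberField K] (p : PrimeIdeal K) : IK K :=
  ⟨p.1, p.2.2⟩

/-- `#k_p`: the cardinality of the residue ring `R ⧸ p`. -/
def residueCard {R : Type} [CommRing R] (p : Ideal R) : ℕ :=
  Nat.card (R ⧸ p)

/-- The shift operator `ψ_a` on `A^{I_K}`: `(ψ_a ξ)_b = ξ_{a·b}`. -/
def shift {K : Type} [Field K] [NumberField K] {A : Type} (a : IK K)
    (ξ : IK K → A) : IK K → A :=
  fun b => ξ (a * b)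

/-- For an ideal `p` of `𝓞 K` and a subset `S ⊆ A^{I_K}`, the set `p·S` of all finite
sums of products of elements of `p` with elements of (the module generated by) `S`. -/
def idealMulSet {K : Type} [Field K] [NumberField K] {A : Type} [CommRing A]
    [Algebra (𝓞 K) A] (p : Ideal (𝓞 K)) (S : Set (IK K → A)) : Set (IK K → A) :=
  ↑(p • Submodule.span (𝓞 K) S)

/-- The descending chain `U_n(A)` of subsets of `A^{I_K}`. -/
def UnSet (K : Type) [Field K] [NumberField K] (A : Type) [CommRing A]
    [Algebra (𝓞 K) A] : ℕ → Set (IK K → A)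
  | 0 => Set.univ
  | n + 1 => {ξ | ξ ∈ UnSet K A n ∧ ∀ p : PrimeIdeal K,
      shift p.toIK ξ - ξ ^ residueCard p.1 ∈ idealMulSet p.1 (UnSet K A n)}

/-- The ring of Witt vectors `W_{O_K}(A) = ⋂ₙ U_n(A)`, as a subset of `A^{I_K}`. -/
def WittSet (K : Type) [Field K] [NumberField K] (A : Type) [CommRing A]
    [Algebra (𝓞 K) A] : Set (IK K → A) :=
  ⋂ n, UnSet K A n

/-- A deterministic finite automaton with output, over input alphabet `Δ` and
output alphabet `O`. -/
structure DFAO (Δ O : Type) : Type 1 where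
  State : Type
  [finState : Finite State]
  trans : State → Δ → State
  start : State
  out : State → O

/-- The output of a DFAO on an input word, processing letters from left to right. -/
def DFAO.output {Δ O : Type} (M : DFAO Δ O) (l : List Δ) : O :=
  M.out (l.foldl M.trans M.start)

/-- `ξ ∈ A^{I_K}` is automatic if some DFAO with input alphabet `P_K` and output
alphabet `A` produces `ξ_a` from every word of primes whose product is `a`. -/
def IsAutomatic {K : Type} [Field K] [NumberField K] {A : Type}
    (ξ : IK K → A) : Prop :=
  ∃ M : DFAO (PrimeIdeal K) A, ∀ (l : List (PrimeIdeal K)) (a : IK K),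
    (a : Ideal (𝓞 K)) = (l.map Subtype.val).prod → ξ a = M.output l

/-- `v_p(a)`: the largest `e` such that `p^e` divides `a`. -/
def vIdeal {R : Type} [CommRing R] (p a : Ideal R) : ℕ :=
  sSup {e : ℕ | p ^ e ∣ a}


lemma aux_reduce {M C : Type*} [CommMonoid M] (ξ : M → C) (p : M) (N f : ℕ) (hf : 0 < f)
    (h : ∀ a, ξ (p ^ (N + f) * a) = ξ (p ^ N * a)) (e : ℕ) :
    ∃ e' < N + f, ∀ a, ξ (p ^ e * a) = ξ (p ^ e' * a) := by
  induction e using Nat.strong_induction_on with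
  | _ e ih =>
    by_cases he : e < N + f
    · exact ⟨e, he, fun _ => rfl⟩
    · obtain ⟨e', he', h'⟩ := ih (e - f) (by omega)
      refine ⟨e', he', fun a => ?_⟩
      rw [← h' a]
      obtain ⟨d, rfl⟩ : ∃ d, e = N + f + d := ⟨e - (N + f), by omega⟩
      have : N + f + d - f = N + d := by omega
      rw [this, pow_add p (N + f) d, pow_add p N d, mul_assoc, mul_assoc, h]

lemma aux_closure {M C : Type*} [CommMonoid M] (ξ : M → C) (S : Set M) (hSf : S.Finite)
    (hS : ∀ p ∈ S, ∃ N f, 0 < f ∧ ∀ a, ξ (p ^ (N + f) * a) = ξ (p ^ N * a)) :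
    ((fun s b => ξ (s * b)) '' (Submonoid.closure S : Set M)).Finite := by
  induction S, hSf using Set.Finite.induction_on with
  | empty => simp
  | @insert p T hp hT ih =>
    have ih' := ih (fun q hq => hS q (Set.mem_insert_of_mem _ hq))
    obtain ⟨N, f, hf, h⟩ := hS p (Set.mem_insert _ _)
    have hfin : (⋃ e ∈ Finset.range (N + f), (fun (g : M → C) b => g (p ^ e * b)) ''
        ((fun s b => ξ (s * b)) '' (Submonoid.closure T : Set M))).Finite :=
      Set.Finite.biUnion (Finset.finite_toSet _) (fun e _ => ih'.image _)
    refine hfin.subset ?_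
    rintro _ ⟨s, hs, rfl⟩
    rw [Set.insert_eq, Submonoid.closure_union, SetLike.mem_coe, Submonoid.mem_sup] at hs
    obtain ⟨y, hy, z, hz, rfl⟩ := hs
    obtain ⟨e, rfl⟩ := Submonoid.mem_closure_singleton.mp hy
    obtain ⟨e', he', h'⟩ := aux_reduce ξ p N f hf h e
    simp only [Set.mem_iUnion]
    refine ⟨e', Finset.mem_range.mpr he', _, ⟨z, hz, rfl⟩, ?_⟩
    funext b
    simp only
    rw [mul_assoc, h', mul_left_comm]

lemma aux_orbit {M C : Type*} [CommMonoid M] [Finite C] (ξ : M → C) (hsurj : ξ.Surjective)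
    (S : Set M) (hSf : S.Finite)
    (hS : ∀ p ∈ S, ∃ N f, 0 < f ∧ ∀ a, ξ (p ^ (N + f) * a) = ξ (p ^ N * a))
    (hG : ∀ a, ∃ m s, a = m * s ∧ s ∈ Submonoid.closure S ∧
      ∀ b c, ξ b = ξ c → ξ (m * b) = ξ (m * c)) :
    (Set.range fun (a : M) b => ξ (a * b)).Finite := by
  have h1 := aux_closure ξ S hSf hS
  refine (Set.Finite.image2 (fun (τ : C → C) (g : M → C) b => τ (g b))
    (Set.finite_univ) h1).subset ?_
  rintro _ ⟨a, rfl⟩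
  obtain ⟨m, s, rfl, hs, hm⟩ := hG a
  refine ⟨fun c => ξ (m * Function.surjInv hsurj c), trivial, _, ⟨s, hs, rfl⟩, ?_⟩
  funext b
  simp only
  rw [mul_assoc]
  exact hm _ _ (Function.surjInv_eq hsurj _)

lemma aux_pow {A : Type*} [CommRing A] (J : Ideal A) (q k : ℕ) (hq : (q : A) ∈ J) (hk : 1 ≤ k)
    (x y : A) (h : x - y ∈ J ^ k) : x ^ q - y ^ q ∈ J ^ (k + 1) := by
  rw [← geom_sum₂_mul, mul_comm, pow_succ]
  refine Ideal.mul_mem_mul h ?_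
  have hxy : x - y ∈ J := Ideal.pow_le_self (by omega) h
  rw [← Ideal.Quotient.eq_zero_iff_mem] at hq ⊢
  rw [← Ideal.Quotient.eq] at hxy
  simp only [map_sum, map_mul, map_pow, hxy]
  rw [geom_sum₂_self]
  rw [map_natCast] at hq
  rw [hq, zero_mul]

section
variable {K : Type} [Field K] [NumberField K] {A : Type} [CommRing A] [Algebra (𝓞 K) A]

lemma aux_smul (p : PrimeIdeal K) (U : Set (IK K → A)) (J : Ideal A)
    (N f : ℕ) (hU : ∀ ξ ∈ U, ∀ a, ξ (p.toIK ^ (N + f) * a) - ξ (p.toIK ^ N * a) ∈ J)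
    (η : IK K → A) (hη : η ∈ idealMulSet p.1 U) (a : IK K) :
    η (p.toIK ^ (N + f) * a) - η (p.toIK ^ N * a) ∈ p.1.map (algebraMap (𝓞 K) A) * J := by
  have hspan : ∀ ξ ∈ Submodule.span (𝓞 K) U,
      ξ (p.toIK ^ (N + f) * a) - ξ (p.toIK ^ N * a) ∈ J := by
    intro ξ hξ
    induction hξ using Submodule.span_induction with
    | mem x hx => exact hU x hx a
    | zero => simp
    | add x y _ _ hx hy =>
      simp only [Pi.add_apply]
      rw [add_sub_add_comm]
      exact J.add_mem hx hy
    | smul r x _ hx =>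
      simp only [Pi.smul_apply]
      rw [← smul_sub, Algebra.smul_def]
      exact J.mul_mem_left _ hx
  unfold idealMulSet at hη
  rw [SetLike.mem_coe] at hη
  induction hη using Submodule.smul_induction_on' with
  | smul r hr x hx =>
    simp only [Pi.smul_apply]
    rw [← smul_sub, Algebra.smul_def]
    exact Ideal.mul_mem_mul (Ideal.mem_map_of_mem _ hr) (hspan x hx)
  | add x _ y _ hx hy =>
    simp only [Pi.add_apply]
    rw [add_sub_add_comm]
    exact Ideal.add_mem _ hx hy

lemma aux_smul_mem (p : PrimeIdeal K) (U : Set (IK K → A))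
    (η : IK K → A) (hη : η ∈ idealMulSet p.1 U) (a : IK K) :
    η a ∈ p.1.map (algebraMap (𝓞 K) A) := by
  unfold idealMulSet at hη
  rw [SetLike.mem_coe] at hη
  induction hη using Submodule.smul_induction_on' with
  | smul r hr x hx =>
    simp only [Pi.smul_apply]
    rw [Algebra.smul_def]
    exact Ideal.mul_mem_right _ _ (Ideal.mem_map_of_mem _ hr)
  | add x _ y _ hx hy => exact Ideal.add_mem _ hx hy

lemma aux_periodic (p : PrimeIdeal K)
    [Finite (A ⧸ p.1.map (algebraMap (𝓞 K) A))] :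
    ∃ f, 0 < f ∧ ∀ k, ∃ N, ∀ ξ ∈ UnSet K A k, ∀ a,
      ξ (p.toIK ^ (N + f) * a) - ξ (p.toIK ^ N * a) ∈ (p.1.map (algebraMap (𝓞 K) A)) ^ k := by
  set J := p.1.map (algebraMap (𝓞 K) A) with hJ
  set q := residueCard p.1 with hqd
  have hq : (q : A) ∈ J := by
    have : ((q : ℕ) : 𝓞 K) ∈ p.1 := by
      rw [← Ideal.Quotient.eq_zero_iff_mem, map_natCast, hqd, residueCard]
      have : Finite (𝓞 K ⧸ p.1) := Ideal.finiteQuotientOfFreeOfNeBot _ p.2.2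
      have := Fintype.ofFinite (𝓞 K ⧸ p.1)
      rw [Nat.card_eq_fintype_card]
      exact Nat.cast_card_eq_zero (𝓞 K ⧸ p.1)
    simpa using Ideal.mem_map_of_mem (algebraMap (𝓞 K) A) this
  let Φ : A ⧸ J → A ⧸ J := fun y => y ^ q
  obtain ⟨m, n, hmn, hΦ⟩ : ∃ m n : ℕ, m < n ∧ Φ^[m] = Φ^[n] := by
    obtain ⟨m, n, hne, h⟩ := Finite.exists_ne_map_eq_of_infinite (fun n : ℕ => Φ^[n])
    rcases lt_or_gt_of_ne hne with h' | h'
    · exact ⟨m, n, h', h⟩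
    · exact ⟨n, m, h', h.symm⟩
  refine ⟨n - m, by omega, fun k => ?_⟩
  induction k with
  | zero => exact ⟨0, fun ξ _ a => by simp⟩
  | succ k ih =>
    rcases Nat.eq_zero_or_pos k with rfl | hk
    · refine ⟨m, fun ξ hξ a => ?_⟩
      have key : ∀ n, Ideal.Quotient.mk J (ξ (p.toIK ^ n * a)) =
          Φ^[n] (Ideal.Quotient.mk J (ξ a)) := by
        intro n
        induction n with
        | zero => simp
        | succ n ihn =>
          rw [Function.iterate_succ_apply', ← ihn]
          have := aux_smul_mem p _ _ (hξ.2 p) (p.toIK ^ n * a)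
          simp only [Pi.sub_apply, shift, Pi.pow_apply] at this
          rw [pow_succ', mul_assoc]
          rw [← Ideal.Quotient.eq] at this
          rw [this, map_pow]
      rw [zero_add, pow_one, ← Ideal.Quotient.eq, key, key, hΦ]
      congr 2
      omega
    · obtain ⟨N, hN⟩ := ih
      refine ⟨N + 1, fun ξ hξ a => ?_⟩
      have h1 := aux_smul p _ _ N (n - m) hN _ (hξ.2 p) a
      have h2 := aux_pow J q k hq hk _ _ (hN ξ hξ.1 a)
      rw [← hJ, ← pow_succ'] at h1
      have h3 := Ideal.add_mem _ h1 h2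
      simp only [Pi.sub_apply, shift, Pi.pow_apply] at h3
      have e1 : N + 1 + (n - m) = (N + (n - m)) + 1 := by omega
      rw [e1, pow_succ' p.toIK (N + (n - m)), pow_succ' p.toIK N, mul_assoc, mul_assoc]
      convert h3 using 1
      ring
end

section
variable {K : Type} [Field K] [NumberField K] {L : Type} [Field L] [NumberField L] [Algebra K L]

lemma aux_inj : Function.Injective (algebraMap (𝓞 K) (𝓞 L)) :=
  FaithfulSMul.algebraMap_injective _ _

lemma aux_comap (p : PrimeIdeal K) :
    (p.1.map (algebraMap (𝓞 K) (𝓞 L))).comap (algebraMap (𝓞 K) (𝓞 L)) = p.1 := by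
  haveI := p.2.1
  obtain ⟨Q, hQ, h⟩ := Ideal.exists_ideal_over_prime_of_isIntegral (S := 𝓞 L) p.1 ⊥ (by
    rw [← RingHom.ker_eq_comap_bot, (RingHom.injective_iff_ker_eq_bot _).mp aux_inj]
    exact bot_le)
  refine le_antisymm ?_ Ideal.le_comap_map
  calc _ ≤ Q.comap (algebraMap (𝓞 K) (𝓞 L)) :=
        Ideal.comap_mono (Ideal.map_le_iff_le_comap.mpr h.2.ge)
    _ = p.1 := h.2

lemma aux_ne_top (p : PrimeIdeal K) : p.1.map (algebraMap (𝓞 K) (𝓞 L)) ≠ ⊤ := by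
  intro h
  have := aux_comap (L := L) p
  rw [h, Ideal.comap_top] at this
  exact p.2.1.ne_top this.symm

lemma aux_ne_bot (p : PrimeIdeal K) : p.1.map (algebraMap (𝓞 K) (𝓞 L)) ≠ ⊥ := by
  intro h
  exact p.2.2 ((Ideal.map_eq_bot_iff_of_injective aux_inj).mp h)

lemma aux_finite_primes (x : 𝓞 L) (hx : x ≠ 0) :
    {p : PrimeIdeal K | x ∈ p.1.map (algebraMap (𝓞 K) (𝓞 L))}.Finite := by
  set I := (Ideal.span {x}).comap (algebraMap (𝓞 K) (𝓞 L)) with hI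
  have hI0 : I ≠ ⊥ := by
    refine Ideal.comap_ne_bot_of_integral_mem hx (Ideal.mem_span_singleton_self x) ?_
    exact Algebra.IsIntegral.isIntegral x
  have hfin := Ideal.finite_factors hI0
  refine Set.Finite.of_finite_image (f := fun p : PrimeIdeal K =>
    (⟨p.1, p.2.1, p.2.2⟩ : IsDedekindDomain.HeightOneSpectrum (𝓞 K))) (hfin.subset ?_) ?_
  · rintro _ ⟨p, hp, rfl⟩
    simp only [Set.mem_setOf_eq] at hp ⊢
    rw [Ideal.dvd_iff_le]
    rw [← aux_comap (L := L) p]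
    refine Ideal.comap_mono ?_
    rwa [Ideal.span_singleton_le_iff_mem]
  · intro p _ p' _ h
    exact Subtype.ext (congrArg IsDedekindDomain.HeightOneSpectrum.asIdeal h)

lemma aux_sep (J : Ideal (𝓞 L)) (hJ : J ≠ ⊤) (C : Set (𝓞 L)) (hC : C.Finite) :
    ∃ k, ∀ c ∈ C, ∀ d ∈ C, c - d ∈ J ^ k → c = d := by
  have h1 : ∀ x : 𝓞 L, x ≠ 0 → ∃ k, x ∉ J ^ k := by
    intro x hx
    by_contra! h
    have : x ∈ ⨅ i, J ^ i := by simpa [Ideal.mem_iInf] using h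
    rw [Ideal.iInf_pow_eq_bot_of_isDomain J hJ] at this
    exact hx this
  choose! κ hκ using h1
  obtain ⟨B, hB⟩ := ((hC.prod hC).image (fun z : 𝓞 L × 𝓞 L => κ (z.1 - z.2))).bddAbove
  refine ⟨B, fun c hc d hd h => ?_⟩
  by_contra hne
  exact hκ _ (sub_ne_zero.mpr hne) (Ideal.pow_le_pow_right (hB ⟨(c, d), ⟨hc, hd⟩, rfl⟩) h)

lemma aux_all (G : Submonoid (IK K)) (h : ∀ p : PrimeIdeal K, p.toIK ∈ G) (a : IK K) : a ∈ G := by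
  obtain ⟨I, hI⟩ := a
  induction I using UniqueFactorizationMonoid.induction_on_prime with
  | h₁ => exact absurd rfl hI
  | h₂ x hx =>
    have : (⟨x, hI⟩ : IK K) = 1 := Subtype.ext (by simpa using hx)
    rw [this]; exact G.one_mem
  | h₃ b q hb hq ih =>
    have hqp : q.IsPrime := Ideal.isPrime_of_prime hq
    have : (⟨q * b, hI⟩ : IK K) = PrimeIdeal.toIK ⟨q, hqp, hq.ne_zero⟩ * ⟨b, hb⟩ := rfl
    rw [this]
    exact G.mul_mem (h _) (ih hb)
end

/-- for a finite extension `L/K` of number fields, if `ξ ∈ W_{O_K}(O_L)`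
has a finite set of coefficient values, then its orbit under the shift operators is
also finite. -/
theorem orbit_finite_of_coeffs_finite_ext (K : Type) [Field K] [NumberField K]
    (L : Type) [Field L] [NumberField L] [Algebra K L] [FiniteDimensional K L]
    (ξ : IK K → 𝓞 L) (hξ : ξ ∈ WittSet K (𝓞 L))
    (hC : (Set.range ξ).Finite) :
    (Set.range fun a : IK K => shift a ξ).Finite := by
  haveI : Finite (Set.range ξ) := hC
  have hmem : ∀ k, ξ ∈ UnSet K (𝓞 L) k := fun k => Set.mem_iInter.mp hξ k
  let ξ' : IK K → Set.range ξ := Set.rangeFactorization ξ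
  have heq : ∀ b c, ξ' b = ξ' c ↔ ξ b = ξ c := fun b c => Subtype.ext_iff
  let S : Set (PrimeIdeal K) := ⋃ z ∈ {z : 𝓞 L × 𝓞 L | z ∈ Set.range ξ ×ˢ Set.range ξ ∧ z.1 ≠ z.2},
    {p : PrimeIdeal K | z.1 - z.2 ∈ p.1.map (algebraMap (𝓞 K) (𝓞 L))}
  have hSf : S.Finite := by
    refine Set.Finite.biUnion ((hC.prod hC).subset fun z hz => hz.1) fun z hz => ?_
    exact aux_finite_primes _ (sub_ne_zero.mpr hz.2)
  let G : Submonoid (IK K) :=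
    { carrier := {m | ∀ b c, ξ' b = ξ' c → ξ' (m * b) = ξ' (m * c)}
      one_mem' := by intro b c h; simpa using h
      mul_mem' := by
        intro m n hm hn b c h
        rw [mul_assoc, mul_assoc]
        exact hm _ _ (hn _ _ h) }
  have hgood : ∀ p : PrimeIdeal K, p ∉ S → p.toIK ∈ G := by
    intro p hp b c h
    rw [heq] at h ⊢
    by_contra hne
    apply hp
    refine Set.mem_biUnion (x := (ξ (p.toIK * b), ξ (p.toIK * c)))
      ⟨⟨⟨_, rfl⟩, ⟨_, rfl⟩⟩, hne⟩ ?_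
    have h1 := aux_smul_mem p _ _ ((hmem 1).2 p) b
    have h2 := aux_smul_mem p _ _ ((hmem 1).2 p) c
    have h3 := Ideal.sub_mem _ h1 h2
    simpa [shift, h] using h3
  have horb := aux_orbit ξ' Set.rangeFactorization_surjective (PrimeIdeal.toIK '' S)
    (hSf.image _) (by
      rintro _ ⟨p, -, rfl⟩
      haveI : Finite (𝓞 L ⧸ p.1.map (algebraMap (𝓞 K) (𝓞 L))) :=
        Ideal.finiteQuotientOfFreeOfNeBot _ (aux_ne_bot p)
      obtain ⟨f, hf, h⟩ := aux_periodic (A := 𝓞 L) p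
      obtain ⟨k, hk⟩ := aux_sep _ (aux_ne_top p) (Set.range ξ) hC
      obtain ⟨N, hN⟩ := h k
      refine ⟨N, f, hf, fun a => ?_⟩
      rw [heq]
      exact hk _ ⟨_, rfl⟩ _ ⟨_, rfl⟩ (hN ξ (hmem k) a)) (by
      intro a
      have ha : a ∈ G ⊔ Submonoid.closure (PrimeIdeal.toIK '' S) := by
        refine aux_all _ (fun p => ?_) a
        by_cases hp : p ∈ S
        · exact Submonoid.mem_sup_right (Submonoid.subset_closure ⟨p, hp, rfl⟩)
        · exact Submonoid.mem_sup_left (hgood p hp)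
      obtain ⟨m, hm, s, hs, rfl⟩ := Submonoid.mem_sup.mp ha
      exact ⟨m, s, rfl, hs, hm⟩)
  refine (horb.image (fun (g : IK K → Set.range ξ) b => (g b : 𝓞 L))).subset ?_
  rintro _ ⟨a, rfl⟩
  exact ⟨_, ⟨a, rfl⟩, rfl⟩

end
end

section
/- (Arithmetic analogue of Christol's theorem.) Let L/K be a finite extension of number fields. For a Witt vector ξ ∈ W_{O_K}(O_L), the following four conditions are equivalent: (1) ξ is integral over O_K (with respect to the structure map sending c ∈ O_K to the constant vector with all coefficients c·1_{O_L}); (2) the set of coefficients C_ξ = { ξ_a ∈ O_L : a ∈ I_K } is finite; (3) the orbit I_K·ξ = { ψ_a ξ : a ∈ I_K } under the shift operators is finite; (4) ξ is automatic. -/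
open NumberField

noncomputable section

section Helpers

variable {K : Type} [Field K] [NumberField K]

instance PrimeIdeal.instIsPrime (p : PrimeIdeal K) : p.1.IsPrime := p.2.1

theorem PrimeIdeal.isMaximal (p : PrimeIdeal K) : p.1.IsMaximal :=
  p.2.1.isMaximal p.2.2

theorem PrimeIdeal.prime (p : PrimeIdeal K) : Prime p.1 :=
  Ideal.prime_of_isPrime p.2.2 p.2.1

theorem word_nil : ((([] : List (PrimeIdeal K)).map Subtype.val).prod : Ideal (𝓞 K)) = 1 :=
  List.prod_nil

theorem word_cons (p : PrimeIdeal K) (l : List (PrimeIdeal K)) :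
    (((p :: l).map Subtype.val).prod : Ideal (𝓞 K)) = p.1 * (l.map Subtype.val).prod :=
  List.prod_cons

/-- every nonzero ideal is a product of a word of primes -/
theorem exists_word (a : IK K) :
    ∃ l : List (PrimeIdeal K), (a : Ideal (𝓞 K)) = (l.map Subtype.val).prod := by
  obtain ⟨I, hI⟩ := a
  change ∃ l : List (PrimeIdeal K), I = (l.map Subtype.val).prod
  have hI' : I ≠ 0 := hI
  clear hI
  induction I using UniqueFactorizationMonoid.induction_on_prime with
  | h₁ => exact absurd rfl hI'
  | h₂ x hx => exact ⟨[], (isUnit_iff_eq_one.1 hx).trans word_nil.symm⟩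
  | h₃ b p hb hp ih =>
    obtain ⟨l, hl⟩ := ih hb
    let p' : PrimeIdeal K := ⟨p, Ideal.isPrime_of_prime hp, hp.ne_zero⟩
    refine ⟨p' :: l, ?_⟩
    have h2 := word_cons p' l
    rw [h2, ← hl]

theorem word_ind {M : IK K → Prop} (h1 : M 1)
    (hs : ∀ (p : PrimeIdeal K) a, M a → M (p.toIK * a)) (a : IK K) : M a := by
  obtain ⟨l, hl⟩ := exists_word a
  induction l generalizing a with
  | nil =>
    have : a = 1 := Subtype.ext (hl.trans word_nil)
    exact this ▸ h1
  | cons p l ih =>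
    have hne : (l.map Subtype.val).prod ≠ (⊥ : Ideal (𝓞 K)) := by
      intro h
      apply a.2
      change (a : Ideal (𝓞 K)) = ⊥
      exact hl.trans ((word_cons p l).trans ((congrArg (p.1 * ·) h).trans (Ideal.mul_bot _)))
    have : a = p.toIK * ⟨(l.map Subtype.val).prod, hne⟩ := Subtype.ext (hl.trans (word_cons p l))
    rw [this]
    exact hs _ _ (ih _ rfl)

theorem residueCard_spec (p : PrimeIdeal K) :
    ∃ l n : ℕ, l.Prime ∧ 0 < n ∧ residueCard p.1 = l ^ n ∧ (l : 𝓞 K) ∈ p.1 ∧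
      ∀ r : 𝓞 K, r ^ residueCard p.1 - r ∈ p.1 := by
  have := p.isMaximal
  letI : Field (𝓞 K ⧸ p.1) := Ideal.Quotient.field p.1
  letI : Fintype (𝓞 K ⧸ p.1) := Fintype.ofFinite _
  obtain ⟨l, hl⟩ := CharP.exists (𝓞 K ⧸ p.1)
  obtain ⟨n, hlp, hn⟩ := FiniteField.card (𝓞 K ⧸ p.1) l
  have hc : residueCard p.1 = Fintype.card (𝓞 K ⧸ p.1) := Nat.card_eq_fintype_card
  refine ⟨l, n, hlp, n.2, hc.trans hn, ?_, fun r => ?_⟩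
  · rw [← Ideal.Quotient.eq_zero_iff_mem, map_natCast]
    exact CharP.cast_eq_zero _ l
  · rw [← Ideal.Quotient.eq_zero_iff_mem, map_sub, map_pow, hc, FiniteField.pow_card, sub_self]

theorem two_le_residueCard (p : PrimeIdeal K) : 2 ≤ residueCard p.1 := by
  obtain ⟨l, n, hl, hn, h, -, -⟩ := residueCard_spec p
  rw [h]
  calc 2 ≤ l := hl.two_le
    _ ≤ l ^ n := Nat.le_self_pow hn.ne' l

variable {A : Type} [CommRing A] [Algebra (𝓞 K) A]

/-- the shift as an algebra homomorphism -/
def shiftHom (a : IK K) : (IK K → A) →ₐ[𝓞 K] (IK K → A) where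
  toFun := shift a
  map_one' := rfl
  map_mul' _ _ := rfl
  map_zero' := rfl
  map_add' _ _ := rfl
  commutes' _ := rfl

theorem shiftHom_apply (a : IK K) (x : IK K → A) : shiftHom a x = shift a x := rfl

theorem frob_add (p : PrimeIdeal K) (S : Subalgebra (𝓞 K) (IK K → A)) {x y : IK K → A}
    (hx : x ∈ S) (hy : y ∈ S) :
    (x + y) ^ residueCard p.1 - (x ^ residueCard p.1 + y ^ residueCard p.1) ∈
      p.1 • Subalgebra.toSubmodule S := by
  obtain ⟨l, n, hl, hn, h, hm, -⟩ := residueCard_spec p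
  obtain ⟨r, hr⟩ := exists_add_pow_prime_pow_eq hl (⟨x, hx⟩ : S) ⟨y, hy⟩ n
  have hr' := congrArg Subtype.val hr
  simp only [Subalgebra.coe_add, Subalgebra.coe_pow, Subalgebra.coe_mul] at hr'
  rw [h, hr']
  have : x ^ l ^ n + y ^ l ^ n + ((l : S) : IK K → A) * x * y * (r : IK K → A)
      - (x ^ l ^ n + y ^ l ^ n) = (l : 𝓞 K) • (x * y * (r : IK K → A)) := by
    rw [Algebra.smul_def, map_natCast]
    simp [mul_assoc]
  rw [this]
  exact Submodule.smul_mem_smul hm (S.mul_mem (S.mul_mem hx hy) r.2)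

theorem unSet_isSubalgebra (n : ℕ) :
    ∃ S : Subalgebra (𝓞 K) (IK K → A), (S : Set (IK K → A)) = UnSet K A n := by
  induction n with
  | zero => exact ⟨⊤, by simp [UnSet]⟩
  | succ n ih =>
    obtain ⟨S, hS⟩ := ih
    have key : ∀ x, x ∈ UnSet K A (n + 1) ↔ x ∈ S ∧ ∀ p : PrimeIdeal K,
        shiftHom p.toIK x - x ^ residueCard p.1 ∈ p.1 • Subalgebra.toSubmodule S := by
      intro x
      have : Submodule.span (𝓞 K) (UnSet K A n) = Subalgebra.toSubmodule S := by
        rw [← hS]; exact Submodule.span_eq (Subalgebra.toSubmodule S)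
      simp only [UnSet, idealMulSet, Set.mem_setOf_eq, ← hS, this, SetLike.mem_coe,
        shiftHom_apply]
      rw [hS, this]
    have mulr : ∀ (p : PrimeIdeal K) (z y : IK K → A),
        z ∈ p.1 • Subalgebra.toSubmodule S → y ∈ S → y * z ∈ p.1 • Subalgebra.toSubmodule S := by
      intro p z y hz hy
      refine Submodule.smul_induction_on hz (fun r hr m hm => ?_) (fun a b ha hb => ?_)
      · rw [mul_smul_comm]
        exact Submodule.smul_mem_smul hr (S.mul_mem hy hm)
      · rw [mul_add]; exact Submodule.add_mem _ ha hb
    have leS : ∀ (p : PrimeIdeal K) (z : IK K → A),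
        z ∈ p.1 • Subalgebra.toSubmodule S → z ∈ S := fun p z hz =>
      Submodule.smul_le_right hz
    refine ⟨{ carrier := UnSet K A (n + 1), mul_mem' := ?_, add_mem' := ?_,
              algebraMap_mem' := ?_ }, rfl⟩
    · intro x y hx hy
      rw [key] at hx hy ⊢
      refine ⟨S.mul_mem hx.1 hy.1, fun p => ?_⟩
      have hψ : shiftHom p.toIK x ∈ S := by
        have := S.add_mem (leS p _ (hx.2 p)) (S.pow_mem hx.1 (residueCard p.1))
        simpa using this
      have := Submodule.add_mem _ (mulr p _ _ (hy.2 p) hψ)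
        (mulr p _ _ (hx.2 p) (S.pow_mem hy.1 (residueCard p.1)))
      convert this using 1
      rw [map_mul, mul_pow]; ring
    · intro x y hx hy
      rw [key] at hx hy ⊢
      refine ⟨S.add_mem hx.1 hy.1, fun p => ?_⟩
      have := Submodule.sub_mem _ (Submodule.add_mem _ (hx.2 p) (hy.2 p))
        (frob_add p S hx.1 hy.1)
      convert this using 1
      rw [map_add]; ring
    · intro r
      rw [key]
      refine ⟨S.algebraMap_mem r, fun p => ?_⟩
      obtain ⟨l, m, hl, hm, h, hlm, hr⟩ := residueCard_spec p
      have : shiftHom p.toIK (algebraMap (𝓞 K) (IK K → A) r) -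
          (algebraMap (𝓞 K) (IK K → A) r) ^ residueCard p.1 =
          (-(r ^ residueCard p.1 - r)) • (1 : IK K → A) := by
        rw [AlgHom.commutes, Algebra.smul_def, map_neg, map_sub, map_pow]; ring
      rw [this]
      exact Submodule.smul_mem_smul (p.1.neg_mem (hr r)) S.one_mem

/-- `U_n` as a subalgebra. -/
def UnAlg (K : Type) [Field K] [NumberField K] (A : Type) [CommRing A]
    [Algebra (𝓞 K) A] (n : ℕ) : Subalgebra (𝓞 K) (IK K → A) :=
  (unSet_isSubalgebra (K := K) (A := A) n).choose

theorem coe_UnAlg (n : ℕ) : (UnAlg K A n : Set (IK K → A)) = UnSet K A n :=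
  (unSet_isSubalgebra (K := K) (A := A) n).choose_spec

theorem mem_UnAlg (n : ℕ) (x : IK K → A) : x ∈ UnAlg K A n ↔ x ∈ UnSet K A n := by
  rw [← coe_UnAlg]; rfl

theorem mem_UnAlg_succ (n : ℕ) (x : IK K → A) : x ∈ UnAlg K A (n + 1) ↔ x ∈ UnAlg K A n ∧
    ∀ p : PrimeIdeal K, shiftHom p.toIK x - x ^ residueCard p.1 ∈
      p.1 • Subalgebra.toSubmodule (UnAlg K A n) := by
  have : Submodule.span (𝓞 K) (UnSet K A n) = Subalgebra.toSubmodule (UnAlg K A n) := by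
    rw [← coe_UnAlg]; exact Submodule.span_eq (Subalgebra.toSubmodule (UnAlg K A n))
  rw [mem_UnAlg, mem_UnAlg, ← this]
  rfl

theorem shift_mem_UnAlg (a : IK K) (n : ℕ) (x : IK K → A) (hx : x ∈ UnAlg K A n) :
    shiftHom a x ∈ UnAlg K A n := by
  induction n generalizing x with
  | zero => rw [mem_UnAlg]; trivial
  | succ n ih =>
    rw [mem_UnAlg_succ] at hx ⊢
    refine ⟨ih _ hx.1, fun p => ?_⟩
    have h1 : shiftHom p.toIK (shiftHom a x) - (shiftHom a x) ^ residueCard p.1 =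
        shiftHom a (shiftHom p.toIK x - x ^ residueCard p.1) := by
      rw [map_sub, map_pow]
      congr 1
      funext b
      change x (a * (p.toIK * b)) = x (p.toIK * (a * b))
      rw [mul_left_comm]
    rw [h1]
    refine Submodule.smul_induction_on (hx.2 p) (fun r hr m hm => ?_) (fun u v hu hv => ?_)
    · rw [map_smul]
      exact Submodule.smul_mem_smul hr (ih _ hm)
    · rw [map_add]; exact Submodule.add_mem _ hu hv

/-- valuation lemma -/
theorem exists_val {B : Type} [CommRing B] [IsDedekindDomain B] (P : Ideal B) [P.IsPrime]
    (hP : P ≠ ⊥) (x : B) (hx : x ≠ 0) :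
    ∃ e : ℕ, (∀ (k : ℕ) (w : B), x * w ∈ P ^ k ↔ w ∈ P ^ (k - e)) ∧ (x ∈ P ↔ 1 ≤ e) := by
  have hpr : Prime P := Ideal.prime_of_isPrime hP inferInstance
  have hfin : FiniteMultiplicity P (Ideal.span {x}) :=
    FiniteMultiplicity.of_prime_left hpr (by simpa using hx)
  have h1 : ∀ (k : ℕ) (w : B), x * w ∈ P ^ k ↔ w ∈ P ^ (k - multiplicity P (Ideal.span {x})) := by
    intro k w
    rw [← Ideal.dvd_span_singleton, ← Ideal.dvd_span_singleton,
      ← Ideal.span_singleton_mul_span_singleton, pow_dvd_iff_le_emultiplicity,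
      pow_dvd_iff_le_emultiplicity, emultiplicity_mul hpr, hfin.emultiplicity_eq_multiplicity]
    generalize multiplicity P (Ideal.span {x}) = e
    generalize emultiplicity P (Ideal.span {w}) = f
    induction f using ENat.recTopCoe with
    | top => simp
    | coe f => norm_cast; omega
  refine ⟨_, h1, ?_⟩
  have := h1 1 1
  rw [mul_one, pow_one] at this
  rw [this]
  generalize multiplicity P (Ideal.span {x}) = e
  rcases Nat.eq_zero_or_pos e with rfl | h
  · simp only [Nat.sub_zero, pow_one]
    constructor
    · intro h; exact absurd ((Ideal.eq_top_iff_one P).2 h) (Ideal.IsPrime.ne_top inferInstance)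
    · omega
  · have : 1 - e = 0 := by omega
    rw [this]; simp; omega

/-- local uniformizer -/
theorem exists_unif (p : PrimeIdeal K) : ∃ s t : 𝓞 K, s ∉ p.1 ∧ t ∈ p.1 ∧ t ≠ 0 ∧
    ∀ c ∈ p.1, ∃ d, s * c = t * d := by
  have hlt : p.1 ^ 2 < p.1 := by
    have := Ideal.pow_succ_lt_pow p.2.2 1
    simpa using this
  obtain ⟨t, ht, ht2⟩ := Set.exists_of_ssubset hlt
  have hd : p.1 ∣ Ideal.span {t} := Ideal.dvd_span_singleton.2 ht
  obtain ⟨J, hJ⟩ := hd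
  have hJp : ¬ J ≤ p.1 := by
    intro h
    apply ht2
    have h2 : p.1 * p.1 ∣ Ideal.span {t} := by
      rw [hJ]; exact mul_dvd_mul_left _ (Ideal.dvd_iff_le.2 h)
    rw [← pow_two] at h2
    exact Ideal.dvd_span_singleton.1 h2
  obtain ⟨s, hsJ, hs⟩ := Set.not_subset.1 hJp
  refine ⟨s, t, hs, ht, ?_, fun c hc => ?_⟩
  · rintro rfl
    exact ht2 (Ideal.zero_mem _)
  · have : s * c ∈ Ideal.span {t} := by
      rw [hJ, mul_comm s]; exact Ideal.mul_mem_mul hc hsJ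
    exact Ideal.mem_span_singleton.1 this

end Helpers

section Main

variable {K : Type} [Field K] [NumberField K] {B : Type} [CommRing B] [IsDedekindDomain B]
  [Algebra (𝓞 K) B] [FaithfulSMul (𝓞 K) B]

theorem local_claim (p : PrimeIdeal K) (P : Ideal B) [P.IsPrime] (hP : P ≠ ⊥)
    (hPp : P.comap (algebraMap (𝓞 K) B) = p.1) (N : ℕ) :
    ∀ k ≤ N + 1, ∀ d ∈ UnAlg K B (N + 1),
      (d (p.toIK ^ N) ∈ P ^ k ↔ d (p.toIK ^ (N + 1)) ∈ P ^ k) := by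
  obtain ⟨s, t, hs, ht, ht0, hst⟩ := exists_unif p
  have hinj := FaithfulSMul.algebraMap_injective (𝓞 K) B
  have hs0 : s ≠ 0 := fun h => hs (h ▸ p.1.zero_mem)
  have hsP : algebraMap (𝓞 K) B s ∉ P := fun h => hs (hPp ▸ h)
  have htP : algebraMap (𝓞 K) B t ∈ P := by
    have : t ∈ P.comap (algebraMap (𝓞 K) B) := hPp ▸ ht
    exact this
  obtain ⟨e0, hse, hs1⟩ := exists_val P hP (algebraMap (𝓞 K) B s)
    (by simpa using (map_ne_zero_iff _ hinj).2 hs0)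
  obtain ⟨e, hte, ht1⟩ := exists_val P hP (algebraMap (𝓞 K) B t)
    (by simpa using (map_ne_zero_iff _ hinj).2 ht0)
  have he0 : e0 = 0 := by
    by_contra h; exact hsP (hs1.2 (by omega))
  subst he0
  have he : 1 ≤ e := ht1.1 htP
  simp only [Nat.sub_zero] at hse
  have hq := two_le_residueCard p
  -- decomposition
  have dec : ∀ n, ∀ d ∈ UnAlg K B (n + 1), ∃ z : IK K → B, ∃ w ∈ UnAlg K B n,
      (∀ m, d (p.toIK ^ (m + 1)) = d (p.toIK ^ m) ^ residueCard p.1 + z (p.toIK ^ m)) ∧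
      ∀ m k, z (p.toIK ^ m) ∈ P ^ k ↔ w (p.toIK ^ m) ∈ P ^ (k - e) := by
    intro n d hd
    rw [mem_UnAlg_succ] at hd
    have hz := hd.2 p
    set z := shiftHom p.toIK d - d ^ residueCard p.1 with hzdef
    have : ∃ w ∈ UnAlg K B n, s • z = t • w := by
      refine Submodule.smul_induction_on hz (fun r hr m hm => ?_) (fun u v hu hv => ?_)
      · obtain ⟨c, hc⟩ := hst r hr
        exact ⟨c • m, Subalgebra.smul_mem _ hm c, by rw [smul_smul, smul_smul, hc]⟩
      · obtain ⟨w1, h1, h1'⟩ := hu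
        obtain ⟨w2, h2, h2'⟩ := hv
        exact ⟨w1 + w2, Subalgebra.add_mem _ h1 h2, by rw [smul_add, smul_add, h1', h2']⟩
    obtain ⟨w, hw, hzw⟩ := this
    refine ⟨z, w, hw, fun m => ?_, fun m k => ?_⟩
    · rw [hzdef, pow_succ']
      simp [shiftHom_apply, shift]
    · rw [← hse, ← hte]
      have := congrFun hzw (p.toIK ^ m)
      simp only [Pi.smul_apply, Algebra.smul_def] at this
      rw [this]
  have powmem : ∀ (x : B) (j k : ℕ), x ∈ P ^ j → k ≤ 2 * j → x ^ residueCard p.1 ∈ P ^ k := by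
    intro x j k hx hk
    have h1 := Ideal.pow_mem_pow hx (residueCard p.1)
    rw [← pow_mul] at h1
    refine Ideal.pow_le_pow_right ?_ h1
    nlinarith
  have addl : ∀ (k : ℕ) (a b : B), a ∈ P ^ k → (a + b ∈ P ^ k ↔ b ∈ P ^ k) := fun k a b h =>
    Ideal.add_mem_iff_right _ h
  have one_case : ∀ n, ∀ d ∈ UnAlg K B (n + 1), ∀ m,
      (d (p.toIK ^ m) ∈ P ↔ d (p.toIK ^ (m + 1)) ∈ P) := by
    intro n d hd m
    obtain ⟨z, w, hw, h1, h2⟩ := dec n d hd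
    have hz : z (p.toIK ^ m) ∈ P := by
      have := (h2 m 1).2 (by have : 1 - e = 0 := by omega
                             rw [this]; simp)
      simpa using this
    rw [h1, Ideal.add_mem_iff_left _ hz]
    exact (Ideal.IsPrime.pow_mem_iff_mem inferInstance _ (by omega)).symm
  induction N with
  | zero =>
    intro k hk d hd
    obtain rfl | rfl : k = 0 ∨ k = 1 := by omega
    · simp
    · simpa using one_case 0 d hd 0
  | succ N ih =>
    intro k
    induction k with
    | zero => intro _ d _; simp
    | succ k ihk =>
      intro hk d hd
      rcases Nat.eq_zero_or_pos k with rfl | hkpos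
      · simpa using one_case _ d hd (N + 1)
      have hd' : d ∈ UnAlg K B (N + 1) := ((mem_UnAlg_succ _ _).1 hd).1
      obtain ⟨z, w, hw, h1, h2⟩ := dec _ d hd
      have lower : ∀ m, m = N + 1 → d (p.toIK ^ m) ∈ P ^ k →
          (d (p.toIK ^ m) ∈ P ^ (k + 1) ↔ d (p.toIK ^ (m + 1)) ∈ P ^ (k + 1)) := by
        rintro m rfl hm
        have hm' := (ih k (by omega) d hd').2 hm
        rw [h1 (N + 1), addl _ _ _ (powmem _ k (k + 1) hm (by omega)), h1 N,
          addl _ _ _ (powmem _ k (k + 1) hm' (by omega)), h2, h2]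
        exact ih _ (by omega) w hw
      constructor
      · intro h
        exact (lower _ rfl (Ideal.pow_le_pow_right (Nat.le_succ k) h)).1 h
      · intro h
        have h' := (ihk (by omega) d hd).2 (Ideal.pow_le_pow_right (Nat.le_succ k) h)
        exact (lower _ rfl h').2 h

/-- the difference of two shifts of a Witt vector -/
theorem shift_congr (p : PrimeIdeal K) (P : Ideal B) [P.IsPrime] (hP : P ≠ ⊥)
    (hPp : P.comap (algebraMap (𝓞 K) B) = p.1) (N : ℕ) (ξ : IK K → B) (hξ : ξ ∈ WittSet K B)
    (a b : IK K) (h : ξ (p.toIK ^ N * a) = ξ (p.toIK ^ N * b)) :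
    ξ (p.toIK ^ (N + 1) * a) - ξ (p.toIK ^ (N + 1) * b) ∈ P ^ (N + 1) := by
  have hx : ξ ∈ UnAlg K B (N + 1) := by
    rw [mem_UnAlg]; exact Set.mem_iInter.1 hξ _
  have hd : shiftHom a ξ - shiftHom b ξ ∈ UnAlg K B (N + 1) :=
    Subalgebra.sub_mem _ (shift_mem_UnAlg a _ _ hx) (shift_mem_UnAlg b _ _ hx)
  have := (local_claim p P hP hPp N (N + 1) le_rfl _ hd).1 (by
    simp only [Pi.sub_apply, shiftHom_apply, shift, mul_comm a, mul_comm b, h, sub_self]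
    exact Ideal.zero_mem _)
  simpa only [Pi.sub_apply, shiftHom_apply, shift, mul_comm a, mul_comm b] using this

theorem finite_orbit [Algebra.IsIntegral (𝓞 K) B] (ξ : IK K → B) (hξ : ξ ∈ WittSet K B)
    (hfin : (Set.range ξ).Finite) : (Set.range fun a : IK K => shift a ξ).Finite := by
  classical
  have hover : ∀ p : PrimeIdeal K, ∃ P : Ideal B, P.IsPrime ∧ P ≠ ⊥ ∧
      P.comap (algebraMap (𝓞 K) B) = p.1 := by
    intro p
    obtain ⟨P, -, hP, hc⟩ := Ideal.exists_ideal_over_prime_of_isIntegral p.1 (⊥ : Ideal B) (by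
      rw [← RingHom.ker_eq_comap_bot,
        (RingHom.injective_iff_ker_eq_bot _).1 (FaithfulSMul.algebraMap_injective (𝓞 K) B)]
      exact bot_le)
    refine ⟨P, hP, ?_, hc⟩
    rintro rfl
    apply p.2.2
    rw [← hc, ← RingHom.ker_eq_comap_bot,
        (RingHom.injective_iff_ker_eq_bot _).1 (FaithfulSMul.algebraMap_injective (𝓞 K) B)]
  choose P hPp hPb hPc using hover
  -- product of nonzero differences
  let D : Finset B := ((hfin.toFinset ×ˢ hfin.toFinset).image (fun x => x.1 - x.2)).erase 0
  let δ : B := ∏ x ∈ D, x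
  have hδ : δ ≠ 0 := Finset.prod_ne_zero_iff.2 fun x hx => Finset.ne_of_mem_erase hx
  have hdiff : ∀ a b, ξ a ≠ ξ b → ξ a - ξ b ∣ δ := by
    intro a b h
    apply Finset.dvd_prod_of_mem
    refine Finset.mem_erase.2 ⟨sub_ne_zero.2 h, Finset.mem_image.2 ⟨(ξ a, ξ b), ?_, rfl⟩⟩
    simp
  have hN : ∀ p, ∃ N : ℕ, δ ∉ P p ^ (N + 1) := by
    intro p
    have := hPp p
    obtain ⟨e, he, -⟩ := exists_val (P p) (hPb p) δ hδ
    refine ⟨e, fun h => ?_⟩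
    have h2 := (he (e + 1) 1).1 (by simpa using h)
    rw [Nat.add_sub_cancel_left, pow_one] at h2
    exact (hPp p).ne_top ((Ideal.eq_top_iff_one _).2 h2)
  let N : PrimeIdeal K → ℕ := fun p => Nat.find (hN p)
  have hNs : ∀ p, δ ∉ P p ^ (N p + 1) := fun p => Nat.find_spec (hN p)
  have hbad : {p : PrimeIdeal K | N p ≠ 0}.Finite := by
    have hf := Ideal.finite_factors (R := B) (I := Ideal.span {δ}) (by simpa using hδ)
    let f : PrimeIdeal K → IsDedekindDomain.HeightOneSpectrum B := fun p => ⟨P p, hPp p, hPb p⟩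
    have hfi : Function.Injective f := by
      intro p p' h
      have h' : P p = P p' := congrArg IsDedekindDomain.HeightOneSpectrum.asIdeal h
      apply Subtype.ext
      rw [← hPc p, ← hPc p', h']
    refine (hf.preimage hfi.injOn).subset fun p hp => ?_
    change P p ∣ Ideal.span {δ}
    rw [Ideal.dvd_span_singleton]
    by_contra hc
    exact hp ((Nat.find_eq_zero (hN p)).2 (by simpa using hc))
  let bb : Ideal (𝓞 K) := ∏ p ∈ hbad.toFinset, p.1 ^ N p
  have hbb : bb ≠ ⊥ := Finset.prod_ne_zero_iff.2 fun p _ => pow_ne_zero _ p.2.2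
  have hdiv : ∀ p : PrimeIdeal K, p.1 ^ N p ∣ bb := by
    intro p
    by_cases h : N p = 0
    · rw [h]; simp
    · exact Finset.dvd_prod_of_mem (fun p : PrimeIdeal K => p.1 ^ N p)
        (hbad.mem_toFinset.2 h)
  have hF : {b : IK K | (b : Ideal (𝓞 K)) ∣ bb}.Finite := by
    have h1 : {b : Ideal (𝓞 K) | b ∣ bb}.Finite := by
      letI := UniqueFactorizationMonoid.fintypeSubtypeDvd bb hbb
      exact Set.finite_coe_iff.1 (Finite.of_fintype {x // x ∣ bb})
    exact Set.Finite.preimage (f := Subtype.val) Subtype.val_injective.injOn h1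
  -- coefficients as a finite type
  let C := Set.range ξ
  haveI : Finite C := hfin
  let ξ' : IK K → C := fun a => ⟨ξ a, a, rfl⟩
  have hφ : ∀ p : PrimeIdeal K, ∃ φ : C → C, ∀ a,
      ξ' (p.toIK ^ (N p + 1) * a) = φ (ξ' (p.toIK ^ N p * a)) := by
    intro p
    have := hPp p
    have hdet : ∀ a b, ξ' (p.toIK ^ N p * a) = ξ' (p.toIK ^ N p * b) →
        ξ' (p.toIK ^ (N p + 1) * a) = ξ' (p.toIK ^ (N p + 1) * b) := by
      intro a b h
      have h0 : ξ (p.toIK ^ N p * a) = ξ (p.toIK ^ N p * b) := congrArg Subtype.val h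
      have h1 := shift_congr p (P p) (hPb p) (hPc p) (N p) ξ hξ a b h0
      apply Subtype.ext
      by_contra hne
      exact hNs p (Ideal.mem_of_dvd _ (hdiff _ _ hne) h1)
    refine ⟨fun c => if h : ∃ a, ξ' (p.toIK ^ N p * a) = c then
      ξ' (p.toIK ^ (N p + 1) * h.choose) else c, fun a => ?_⟩
    have hex : ∃ a', ξ' (p.toIK ^ N p * a') = ξ' (p.toIK ^ N p * a) := ⟨a, rfl⟩
    refine Eq.trans ?_ (dif_pos hex).symm
    exact hdet _ _ hex.choose_spec.symm
  choose φ hφ using hφ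
  have claim : ∀ a : IK K, ∃ g : C → C, ∃ b ∈ {b : IK K | (b : Ideal (𝓞 K)) ∣ bb},
      ∀ c, ξ' (a * c) = g (ξ' (b * c)) := by
    intro a
    induction a using word_ind with
    | h1 => exact ⟨id, 1, by simp, fun c => rfl⟩
    | hs p a ih =>
      obtain ⟨g, b, hb, h⟩ := ih
      by_cases hpb : p.1 ^ N p ∣ (b : Ideal (𝓞 K))
      · obtain ⟨J, hJ⟩ := hpb
        have hJ0 : J ≠ ⊥ := by
          rintro rfl
          apply b.2
          change (b : Ideal (𝓞 K)) = ⊥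
          rw [hJ]; simp
        have hbe : b = p.toIK ^ N p * ⟨J, hJ0⟩ := Subtype.ext hJ
        refine ⟨g ∘ φ p, b, hb, fun c => ?_⟩
        have e1 : p.toIK * a * c = a * (p.toIK * c) := by rw [mul_comm p.toIK a, mul_assoc]
        rw [e1, h, Function.comp_apply, hbe, mul_assoc (p.toIK ^ N p),
          mul_assoc (p.toIK ^ N p), ← hφ, pow_succ]
        congr 2
        simp only [mul_assoc, mul_left_comm]
      · refine ⟨g, p.toIK * b, ?_, fun c => ?_⟩
        · obtain ⟨c, hc⟩ : (b : Ideal (𝓞 K)) ∣ bb := hb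
          have hpc : p.1 ∣ c := by
            by_contra hnc
            exact hpb (p.prime.pow_dvd_of_dvd_mul_right (N p) hnc (hc ▸ hdiv p))
          change p.1 * (b : Ideal (𝓞 K)) ∣ bb
          rw [hc, mul_comm]
          exact mul_dvd_mul_left _ hpc
        · have e1 : p.toIK * a * c = a * (p.toIK * c) := by rw [mul_comm p.toIK a, mul_assoc]
          rw [e1, h]
          congr 2
          simp only [mul_assoc, mul_left_comm]
  let G : (C → C) × IK K → (IK K → B) := fun x c => (x.1 (ξ' (x.2 * c)) : B)
  refine (((Set.finite_univ (α := C → C)).prod hF).image G).subset ?_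
  rintro _ ⟨a, rfl⟩
  obtain ⟨g, b, hb, h⟩ := claim a
  refine ⟨(g, b), ⟨trivial, hb⟩, ?_⟩
  funext c
  exact (congrArg Subtype.val (h c)).symm

end Main

/-- arithmetic analogue of Christol's theorem: for a finite extension
`L/K` of number fields and `ξ ∈ W_{O_K}(O_L)`, the following are equivalent:
(1) `ξ` is integral over `O_K`; (2) the set of coefficients of `ξ` is finite;
(3) the orbit of `ξ` under the shifts is finite; (4) `ξ` is automatic. -/
theorem arithmetic_christol (K : Type) [Field K] [NumberField K]
    (L : Type) [Field L] [NumberField L] [Algebra K L] [FiniteDimensional K L]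
    (ξ : IK K → 𝓞 L) (hξ : ξ ∈ WittSet K (𝓞 L)) :
    List.TFAE [IsIntegral (𝓞 K) ξ,
      (Set.range ξ).Finite,
      (Set.range fun a : IK K => shift a ξ).Finite,
      IsAutomatic ξ] := by
  haveI : Algebra.IsIntegral (𝓞 K) (𝓞 L) := inferInstance
  tfae_have 1 → 2 := by
    rintro ⟨f, hf, h⟩
    have hf' : f.map (algebraMap (𝓞 K) (𝓞 L)) ≠ 0 := (hf.map _).ne_zero
    refine (Polynomial.finite_setOf_isRoot hf').subset ?_
    rintro _ ⟨a, rfl⟩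
    have h2 : Polynomial.aeval ξ f = 0 := h
    have h3 := congrArg (Pi.evalAlgHom (𝓞 K) (fun _ : IK K => 𝓞 L) a) h2
    rw [← Polynomial.aeval_algHom_apply, map_zero] at h3
    change Polynomial.eval _ _ = 0
    rw [Polynomial.eval_map_algebraMap]
    exact h3
  tfae_have 2 → 1 := by
    intro h
    classical
    choose m hm hm0 using fun c : 𝓞 L => Algebra.IsIntegral.isIntegral (R := 𝓞 K) c
    refine ⟨∏ c ∈ h.toFinset, m c, Polynomial.monic_prod_of_monic _ _ fun c _ => hm c, ?_⟩
    change Polynomial.aeval ξ _ = 0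
    funext a
    change Pi.evalAlgHom (𝓞 K) (fun _ : IK K => 𝓞 L) a (Polynomial.aeval ξ _) = 0
    rw [← Polynomial.aeval_algHom_apply, map_prod]
    exact Finset.prod_eq_zero (i := ξ a) (by simp) (hm0 (ξ a))
  tfae_have 2 → 3 := finite_orbit ξ hξ
  tfae_have 3 → 4 := by
    intro h
    haveI : Finite (Set.range fun a : IK K => shift a ξ) := h
    let M : DFAO (PrimeIdeal K) (𝓞 L) :=
      { State := (Set.range fun a : IK K => shift a ξ)
        trans := fun η p => ⟨shift p.toIK η.1, by
          obtain ⟨_, a, rfl⟩ := η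
          refine ⟨a * p.toIK, ?_⟩
          funext b
          simp only [shift, mul_assoc]⟩
        start := ⟨ξ, 1, by funext b; simp [shift]⟩
        out := fun η => η.1 1 }
    refine ⟨M, fun l => ?_⟩
    have key : ∀ (l : List (PrimeIdeal K)) (η : M.State) (a : IK K),
        (a : Ideal (𝓞 K)) = (l.map Subtype.val).prod → η.1 a = M.out (l.foldl M.trans η) := by
      intro l
      induction l with
      | nil =>
        intro η a ha
        have : a = 1 := Subtype.ext (ha.trans word_nil)
        rw [this]; rfl
      | cons p l ih =>
        intro η a ha
        have hne : (l.map Subtype.val).prod ≠ (⊥ : Ideal (𝓞 K)) := by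
          intro h
          apply a.2
          change (a : Ideal (𝓞 K)) = ⊥
          exact ha.trans ((word_cons p l).trans ((congrArg (p.1 * ·) h).trans (Ideal.mul_bot _)))
        have : a = p.toIK * ⟨(l.map Subtype.val).prod, hne⟩ := Subtype.ext (ha.trans (word_cons p l))
        rw [this, List.foldl_cons, ← ih (M.trans η p) ⟨(l.map Subtype.val).prod, hne⟩ rfl]
        rfl
    exact key l M.start
  tfae_have 4 → 2 := by
    rintro ⟨M, hM⟩
    haveI := M.finState
    refine (Set.finite_range M.out).subset ?_
    rintro _ ⟨a, rfl⟩
    obtain ⟨l, hl⟩ := exists_word a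
    exact ⟨_, (hM l a hl).symm⟩
  tfae_finish

end
end

section
/- Let K be a number field, K̄ an algebraic closure of K, and O_K̄ the integral closure of O_K in K̄. Suppose ξ ∈ W_{O_K}(O_K̄) is integral over O_K, and let O_K⟨ξ⟩ denote the O_K-subalgebra of W_{O_K}(O_K̄) generated by the orbit I_K·ξ = { ψ_a ξ : a ∈ I_K }. Then O_K⟨ξ⟩ is finitely generated as an O_K-module, and the K-algebra K ⊗_{O_K} O_K⟨ξ⟩ is finite-dimensional over K and reduced (hence finite étale over K, as K has characteristic zero). -/
open NumberField

noncomputable section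

set_option synthInstance.maxHeartbeats 1000000
set_option maxHeartbeats 2000000

/-- The `O_K`-subalgebra `O_K⟨ξ⟩` of `O_K̄^{I_K}` generated by the orbit of `ξ` under
the shift operators. -/
def adjoinOrbit (K : Type) [Field K] [NumberField K]
    (ξ : IK K → ↥(integralClosure (𝓞 K) (AlgebraicClosure K))) :
    Subalgebra (𝓞 K) (IK K → ↥(integralClosure (𝓞 K) (AlgebraicClosure K))) :=
  Algebra.adjoin (𝓞 K) (Set.range fun a : IK K => shift a ξ)

section helpers

variable {K : Type} [Field K] [NumberField K]

lemma exists_pi_s (p : PrimeIdeal K) : ∃ π s : 𝓞 K, π ∈ p.1 ∧ π ≠ 0 ∧ s ∉ p.1 ∧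
    ∀ x ∈ p.1, π ∣ s * x := by
  obtain ⟨p, hp, hp0⟩ := p
  dsimp only
  have hlt : p ^ 2 < p := Ideal.pow_lt_self p hp0 hp.ne_top 2 le_rfl
  obtain ⟨π, hπ, hπ2⟩ := SetLike.exists_of_lt hlt
  obtain ⟨b, hb⟩ : p ∣ Ideal.span {π} := by
    rw [Ideal.dvd_span_singleton]; exact hπ
  have hbp : ¬ b ≤ p := by
    intro h
    apply hπ2
    have : Ideal.span {π} ≤ p ^ 2 := by
      rw [hb, pow_two]; exact Ideal.mul_mono le_rfl h
    exact this (Ideal.mem_span_singleton_self π)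
  obtain ⟨s, hs, hsp⟩ := SetLike.not_le_iff_exists.mp hbp
  refine ⟨π, s, hπ, ?_, hsp, ?_⟩
  · rintro rfl; exact hπ2 (zero_mem _)
  · intro x hx
    rw [← Ideal.mem_span_singleton, hb, mul_comm s x]
    exact Ideal.mul_mem_mul hx hs

lemma residueCard_facts (p : PrimeIdeal K) : ∃ l f : ℕ, l.Prime ∧ residueCard p.1 = l ^ f ∧
    (l : 𝓞 K) ∈ p.1 ∧ ∀ c : 𝓞 K, c - c ^ residueCard p.1 ∈ p.1 := by
  obtain ⟨p, hp, hp0⟩ := p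
  dsimp only
  have : p.IsMaximal := hp.isMaximal hp0
  let : Field (𝓞 K ⧸ p) := Ideal.Quotient.field p
  have : Finite (𝓞 K ⧸ p) := Ideal.finiteQuotientOfFreeOfNeBot p hp0
  let := Fintype.ofFinite (𝓞 K ⧸ p)
  obtain ⟨l, hl, f, hlp, hf⟩ := FiniteField.card' (𝓞 K ⧸ p)
  refine ⟨l, f, hlp, ?_, ?_, ?_⟩
  · rw [residueCard, Nat.card_eq_fintype_card, hf]
  · rw [← Ideal.Quotient.eq_zero_iff_mem, map_natCast, CharP.cast_eq_zero]
  · intro c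
    rw [← Ideal.Quotient.eq_zero_iff_mem, map_sub, map_pow, residueCard,
      Nat.card_eq_fintype_card, FiniteField.pow_card, sub_self]

variable {A : Type} [CommRing A] [Algebra (𝓞 K) A]

lemma smul_sub_mul_left (p : Ideal (𝓞 K)) (V : Subalgebra (𝓞 K) (IK K → A))
    {x y : IK K → A} (hx : x ∈ V) (hy : y ∈ p • Subalgebra.toSubmodule V) :
    x * y ∈ p • Subalgebra.toSubmodule V := by
  induction hy using Submodule.smul_induction_on' with
  | smul r hr n hn =>
    rw [mul_smul_comm]
    exact Submodule.smul_mem_smul hr (V.mul_mem hx hn)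
  | add a _ b _ ha hb => rw [mul_add]; exact add_mem ha hb

lemma UnSet_alg (n : ℕ) : ∃ V : Subalgebra (𝓞 K) (IK K → A), (V : Set _) = UnSet K A n := by
  induction n with
  | zero => exact ⟨⊤, by simp [UnSet]⟩
  | succ n ih =>
    obtain ⟨V, hV⟩ := ih
    have key : ∀ x, x ∈ UnSet K A (n+1) ↔ x ∈ V ∧ ∀ p : PrimeIdeal K,
        shift p.toIK x - x ^ residueCard p.1 ∈ p.1 • Subalgebra.toSubmodule V := by
      intro x
      have hs : Submodule.span (𝓞 K) (V : Set (IK K → A)) = Subalgebra.toSubmodule V :=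
        Submodule.span_eq (Subalgebra.toSubmodule V)
      simp only [UnSet, ← hV, idealMulSet, Set.mem_setOf_eq, hs, SetLike.mem_coe]
    have halg : ∀ r : 𝓞 K, algebraMap (𝓞 K) (IK K → A) r ∈ UnSet K A (n+1) := by
      intro r
      rw [key]
      refine ⟨V.algebraMap_mem r, fun p => ?_⟩
      obtain ⟨l, f, hl, hq, hlp, hc⟩ := residueCard_facts p
      have h1 : shift p.toIK (algebraMap (𝓞 K) (IK K → A) r) = algebraMap (𝓞 K) (IK K → A) r := by
        funext b; rfl
      rw [h1, ← map_pow, ← map_sub, Algebra.algebraMap_eq_smul_one]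
      exact Submodule.smul_mem_smul (hc r) V.one_mem
    refine ⟨{ carrier := UnSet K A (n+1), mul_mem' := ?_, add_mem' := ?_, algebraMap_mem' := halg }, rfl⟩
    · intro x y hx hy
      rw [key] at hx hy ⊢
      refine ⟨V.mul_mem hx.1 hy.1, fun p => ?_⟩
      have hle : p.1 • Subalgebra.toSubmodule V ≤ Subalgebra.toSubmodule V := Submodule.smul_le_right
      have e : shift p.toIK (x * y) - (x * y) ^ residueCard p.1 =
          (shift p.toIK x) * (shift p.toIK y - y ^ residueCard p.1) +
          y ^ residueCard p.1 * (shift p.toIK x - x ^ residueCard p.1) := by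
        have : shift p.toIK (x * y) = shift p.toIK x * shift p.toIK y := rfl
        rw [this, mul_pow]; ring
      rw [e]
      have hsx : shift p.toIK x ∈ V := by
        have := add_mem (show _ ∈ V from hle (hx.2 p)) (pow_mem hx.1 (residueCard p.1))
        simpa using this
      exact add_mem (smul_sub_mul_left _ _ hsx (hy.2 p))
        (smul_sub_mul_left _ _ (pow_mem hy.1 _) (hx.2 p))
    · intro x y hx hy
      rw [key] at hx hy ⊢
      refine ⟨V.add_mem hx.1 hy.1, fun p => ?_⟩
      obtain ⟨l, f, hl, hq, hlp, hc⟩ := residueCard_facts p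
      obtain ⟨r, hr⟩ := exists_add_pow_prime_pow_eq hl (⟨x, hx.1⟩ : V) ⟨y, hy.1⟩ f
      have hr' := congrArg (Subtype.val) hr
      have hcast : ((l : V) : IK K → A) = (l : IK K → A) := map_natCast V.subtype l
      simp only [Subalgebra.coe_add, Subalgebra.coe_pow, Subalgebra.coe_mul, hcast] at hr'
      have e : shift p.toIK (x + y) - (x + y) ^ residueCard p.1 =
          (shift p.toIK x - x ^ residueCard p.1) + (shift p.toIK y - y ^ residueCard p.1)
           - (l : 𝓞 K) • ((x * y * r : IK K → A)) := by
        have h1 : shift p.toIK (x + y) = shift p.toIK x + shift p.toIK y := rfl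
        have h2 : ((l : 𝓞 K) • ((x * y * r : IK K → A))) = l * x * y * r := by
          rw [Algebra.smul_def, map_natCast]; ring
        rw [h1, h2, hq, hr']; ring
      rw [e]
      refine sub_mem (add_mem (hx.2 p) (hy.2 p)) (Submodule.smul_mem_smul hlp ?_)
      exact V.mul_mem (V.mul_mem hx.1 hy.1) r.2

/-- multiplying an element of `p • V` by `s` makes it divisible by `π`. -/
lemma exists_eq_pi_smul (p : Ideal (𝓞 K)) (π s : 𝓞 K) (h : ∀ x ∈ p, π ∣ s * x)
    (V : Submodule (𝓞 K) (IK K → A)) {y : IK K → A} (hy : y ∈ p • V) :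
    ∃ z ∈ V, s • y = π • z := by
  induction hy using Submodule.smul_induction_on' with
  | smul r hr n hn =>
    obtain ⟨t, ht⟩ := h r hr
    exact ⟨t • n, V.smul_mem t hn, by rw [smul_smul, smul_smul, ht]⟩
  | add a _ b _ ha hb =>
    obtain ⟨z, hz, e⟩ := ha
    obtain ⟨w, hw, e'⟩ := hb
    exact ⟨z + w, V.add_mem hz hw, by rw [smul_add, smul_add, e, e']⟩

lemma main_congr [IsDomain A] [FaithfulSMul (𝓞 K) A] (p : PrimeIdeal K) (π s : 𝓞 K)
    (hπ0 : π ≠ 0) (h : ∀ x ∈ p.1, π ∣ s * x) (n : ℕ) :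
    ∀ η ∈ UnSet K A n, ∀ a a' : IK K,
      (∀ j < n, η (p.toIK ^ j * a) = η (p.toIK ^ j * a')) →
      algebraMap (𝓞 K) A (π ^ n) ∣
        algebraMap (𝓞 K) A (s ^ n) * (η (p.toIK ^ n * a) - η (p.toIK ^ n * a')) := by
  induction n with
  | zero => intro η _ a a' _; simp
  | succ n ih =>
    intro η hη a a' heq
    obtain ⟨V, hV⟩ := UnSet_alg (K := K) (A := A) n
    have hs : Submodule.span (𝓞 K) (V : Set (IK K → A)) = Subalgebra.toSubmodule V :=
      Submodule.span_eq (Subalgebra.toSubmodule V)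
    have h2 : shift p.toIK η - η ^ residueCard p.1 ∈ p.1 • Subalgebra.toSubmodule V := by
      have := hη.2 p
      rwa [idealMulSet, ← hV, hs] at this
    obtain ⟨z, hz, e⟩ := exists_eq_pi_smul p.1 π s h _ h2
    have hzU : z ∈ UnSet K A n := by rw [← hV]; exact hz
    have e' : ∀ b : IK K, ∀ j, algebraMap (𝓞 K) A s *
        (η (p.toIK ^ (j+1) * b) - η (p.toIK ^ j * b) ^ residueCard p.1) =
        algebraMap (𝓞 K) A π * z (p.toIK ^ j * b) := by
      intro b j
      have := congrFun e (p.toIK ^ j * b)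
      simp only [Pi.smul_apply, Pi.sub_apply, Pi.pow_apply, Algebra.smul_def, shift] at this
      rw [← this, pow_succ', mul_assoc]
    have hπ : algebraMap (𝓞 K) A π ≠ 0 := by
      rwa [Ne, FaithfulSMul.algebraMap_eq_zero_iff]
    have hzz : ∀ j < n, z (p.toIK ^ j * a) = z (p.toIK ^ j * a') := by
      intro j hj
      apply mul_left_cancel₀ hπ
      rw [← e', ← e', heq (j+1) (by omega), heq j (by omega)]
    obtain ⟨w, hw⟩ := ih z hzU a a' hzz
    refine ⟨w, ?_⟩
    have ea := e' a n
    have ea' := e' a' n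
    rw [heq n (by omega)] at ea
    simp only [map_pow] at hw ⊢
    linear_combination (algebraMap (𝓞 K) A s) ^ n * (ea - ea') + algebraMap (𝓞 K) A π * hw

lemma mem_pow_of_dvd (F : Type) [Field F] [Algebra K F] [Algebra (𝓞 K) F] [Algebra A F]
    [IsScalarTower (𝓞 K) K F] [IsScalarTower (𝓞 K) A F] [Algebra.IsIntegral (𝓞 K) A]
    (p : PrimeIdeal K) (π s : 𝓞 K)
    (hπ : π ∈ p.1) (hπ0 : π ≠ 0) (hs : s ∉ p.1) (n : ℕ) (c : 𝓞 K)
    (hd : algebraMap (𝓞 K) A (π ^ n) ∣ algebraMap (𝓞 K) A (s ^ n * c)) : c ∈ p.1 ^ n := by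
  have hd' : π ^ n ∣ s ^ n * c := by
    obtain ⟨w, hw⟩ := hd
    have hwi : IsIntegral (𝓞 K) w := Algebra.IsIntegral.isIntegral w
    have hx : IsIntegral (𝓞 K) (algebraMap (𝓞 K) K (s ^ n * c) / algebraMap (𝓞 K) K (π ^ n)) := by
      have hinj : Function.Injective (algebraMap K F) := (algebraMap K F).injective
      rw [← isIntegral_algebraMap_iff (B := F) hinj]
      have : algebraMap K F (algebraMap (𝓞 K) K (s ^ n * c) / algebraMap (𝓞 K) K (π ^ n)) =
          algebraMap A F w := by
        rw [map_div₀, ← IsScalarTower.algebraMap_apply, ← IsScalarTower.algebraMap_apply,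
          IsScalarTower.algebraMap_apply (𝓞 K) A F, IsScalarTower.algebraMap_apply (𝓞 K) A F (π ^ n),
          hw, map_mul, mul_div_cancel_left₀]
        rw [← IsScalarTower.algebraMap_apply, IsScalarTower.algebraMap_apply (𝓞 K) K F, Ne,
          FaithfulSMul.algebraMap_eq_zero_iff, FaithfulSMul.algebraMap_eq_zero_iff]
        exact pow_ne_zero _ hπ0
      rw [this]
      exact hwi.algebraMap
    obtain ⟨y, hy⟩ := IsIntegrallyClosed.isIntegral_iff.mp hx
    refine ⟨y, ?_⟩
    apply FaithfulSMul.algebraMap_injective (𝓞 K) K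
    rw [map_mul _ (π ^ n), hy, mul_div_cancel₀]
    rw [Ne, FaithfulSMul.algebraMap_eq_zero_iff]
    exact pow_ne_zero _ hπ0
  have hmem : s ^ n * c ∈ p.1 ^ n := Ideal.mem_of_dvd _ hd' (Ideal.pow_mem_pow hπ n)
  have hm : p.1.IsMaximal := p.2.1.isMaximal p.2.2
  have hsu : IsCoprime (Ideal.span {s ^ n}) (p.1 ^ n) := by
    rw [← Ideal.span_singleton_pow]
    apply IsCoprime.pow
    rw [Ideal.isCoprime_iff_sup_eq, sup_comm]
    exact hm.1.2 _ (left_lt_sup.mpr fun h => hs (h (Ideal.mem_span_singleton_self s)))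
  obtain ⟨u, hu, v, hv, huv⟩ := Ideal.isCoprime_iff_exists.mp hsu
  obtain ⟨t, rfl⟩ := Ideal.mem_span_singleton'.mp hu
  have : c = t * (s ^ n * c) + v * c := by linear_combination (-c) * huv
  rw [this]
  exact add_mem (Ideal.mul_mem_left _ _ hmem) (Ideal.mul_mem_right _ _ hv)


/-- The product of the powers `p ^ e p` over `p ∈ T`. -/
def bprod (T : Finset (PrimeIdeal K)) (e : PrimeIdeal K → ℕ) : IK K := ∏ p ∈ T, p.toIK ^ e p

lemma rel_mul {X : Type} (r : IK K → IK K → Prop) (hr : ∀ (p : PrimeIdeal K) a a', r a a' →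
    r (p.toIK * a) (p.toIK * a')) (c : IK K) : ∀ a a', r a a' → r (c * a) (c * a') := by
  obtain ⟨c, hc⟩ := c
  induction c using UniqueFactorizationMonoid.induction_on_prime with
  | h₁ => exact absurd rfl hc
  | h₂ x hx =>
    intro a a' h
    have : (⟨x, hc⟩ : IK K) = 1 := Subtype.ext ((Ideal.isUnit_iff.mp hx).trans Ideal.one_eq_top.symm)
    rwa [this, one_mul, one_mul]
  | h₃ x q hx hq ih =>
    intro a a' h
    let P : PrimeIdeal K := ⟨q, Ideal.isPrime_of_prime hq, hq.ne_zero⟩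
    have : (⟨q * x, hc⟩ : IK K) = P.toIK * ⟨x, hx⟩ := rfl
    rw [this, mul_assoc, mul_assoc]
    exact hr _ _ _ (ih hx _ _ h)

open Classical in
lemma orbit_finite {X : Type} (ξ : IK K → X) (hfin : (Set.range ξ).Finite)
    (T : Finset (PrimeIdeal K)) (m : PrimeIdeal K → ℕ)
    (hm1 : ∀ p ∉ T, m p = 1) (hm0 : ∀ p, 0 < m p)
    (hD : ∀ p a a', (∀ j < m p, ξ (p.toIK ^ j * a) = ξ (p.toIK ^ j * a')) →
      ξ (p.toIK ^ m p * a) = ξ (p.toIK ^ m p * a')) :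
    (Set.range fun a : IK K => shift a ξ).Finite := by
  let r : IK K → IK K → Prop := fun a a' => ∀ e : PrimeIdeal K → ℕ, (∀ p ∈ T, e p < m p) →
    ξ (bprod T e * a) = ξ (bprod T e * a')
  have hr : ∀ (p : PrimeIdeal K) a a', r a a' → r (p.toIK * a) (p.toIK * a') := by
    intro p a a' h e he
    by_cases hp : p ∈ T
    · let b : IK K := ∏ q ∈ T.erase p, q.toIK ^ e q
      have hb : ∀ i, bprod T (Function.update e p i) = p.toIK ^ i * b := by
        intro i
        rw [bprod, ← Finset.mul_prod_erase _ _ hp, Function.update_self]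
        congr 1
        apply Finset.prod_congr rfl
        intro q hq
        rw [Function.update_of_ne (Finset.ne_of_mem_erase hq)]
      have hb' : bprod T e = p.toIK ^ e p * b := by
        rw [← hb, Function.update_eq_self]
      have hlt : ∀ i < m p, ξ (p.toIK ^ i * (b * a)) = ξ (p.toIK ^ i * (b * a')) := by
        intro i hi
        have := h (Function.update e p i) (by
          intro q hq
          by_cases hqp : q = p
          · subst hqp; rwa [Function.update_self]
          · rw [Function.update_of_ne hqp]; exact he q hq)
        rwa [hb, mul_assoc, mul_assoc] at this
      have e1 : ∀ x, bprod T e * (p.toIK * x) = p.toIK ^ (e p + 1) * (b * x) := by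
        intro x; rw [hb', pow_succ]; ac_rfl
      rw [e1, e1]
      rcases (Nat.succ_le_of_lt (he p hp)).lt_or_eq with h1 | h1
      · exact hlt _ h1
      · have h2 : e p + 1 = m p := h1
        rw [h2]
        exact hD p _ _ hlt
    · have := hD p (bprod T e * a) (bprod T e * a') (by
        intro j hj
        rw [hm1 p hp] at hj
        obtain rfl : j = 0 := by omega
        simpa using h e he)
      rw [hm1 p hp, pow_one] at this
      rw [mul_left_comm, this, mul_left_comm]
  have hrξ : ∀ a a', r a a' → shift a ξ = shift a' ξ := by
    intro a a' h
    funext c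
    have := rel_mul (X := X) r hr c a a' h (fun _ => 0) (fun p _ => hm0 p)
    simpa [bprod, shift, mul_comm] using this
  -- the classifying map
  let E := ∀ p : T, Fin (m p)
  let ext : E → PrimeIdeal K → ℕ := fun e p => if h : p ∈ T then e ⟨p, h⟩ else 0
  have : Finite (Set.range ξ) := hfin
  let Φ : IK K → E → Set.range ξ := fun a e => ⟨ξ (bprod T (ext e) * a), _, rfl⟩
  have hΦ : ∀ a a', Φ a = Φ a' → shift a ξ = shift a' ξ := by
    intro a a' h
    apply hrξ
    intro e he
    have h1 := congrArg Subtype.val (congrFun h (fun p => ⟨e p, he p p.2⟩))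
    have h2 : bprod T (ext fun p => ⟨e p, he p p.2⟩) = bprod T e := by
      apply Finset.prod_congr rfl
      intro q hq
      simp [ext, hq]
    simp only [Φ, h2] at h1
    exact h1
  have hsub : (Set.range fun a : IK K => shift a ξ) ⊆
      Set.range (fun y : Set.range Φ => shift (y.2.choose) ξ) := by
    rintro _ ⟨a, rfl⟩
    refine ⟨⟨Φ a, a, rfl⟩, ?_⟩
    apply hΦ
    exact (⟨a, rfl⟩ : ∃ y, Φ y = Φ a).choose_spec
  exact (Set.finite_range _).subset hsub

lemma reduced_tensor (B : Type) [CommRing B] [Algebra (𝓞 K) B] [IsReduced B] :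
    IsReduced (TensorProduct (𝓞 K) K B) := by
  let := Algebra.TensorProduct.rightAlgebra (R := 𝓞 K) (A := K) (B := B)
  have := IsLocalization.tensorRight (R := 𝓞 K) (S := B) (A := K) (nonZeroDivisors (𝓞 K))
  exact isReduced_localizationPreserves (Algebra.algebraMapSubmonoid B (nonZeroDivisors (𝓞 K))) _
    inferInstance

lemma witt_orbit_finite [IsDomain A] [FaithfulSMul (𝓞 K) A]
    (F : Type) [Field F] [Algebra K F] [Algebra (𝓞 K) F] [Algebra A F]
    [IsScalarTower (𝓞 K) K F] [IsScalarTower (𝓞 K) A F] [Algebra.IsIntegral (𝓞 K) A]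
    (ξ : IK K → A) (hξ : ξ ∈ WittSet K A) (hint : IsIntegral (𝓞 K) ξ) :
    (Set.range fun a : IK K => shift a ξ).Finite := by
  classical
  obtain ⟨f, hf, hf0⟩ := hint
  have hfin : (Set.range ξ).Finite := by
    apply ((f.map (algebraMap (𝓞 K) A)).roots.toFinset.finite_toSet).subset
    rintro _ ⟨a, rfl⟩
    simp only [Finset.mem_coe, Multiset.mem_toFinset]
    rw [Polynomial.mem_roots (hf.map _).ne_zero, Polynomial.IsRoot, Polynomial.eval_map_algebraMap]
    have := congrArg (Pi.evalAlgHom (𝓞 K) (fun _ : IK K => A) a) hf0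
    rw [← Polynomial.aeval_def, ← Polynomial.aeval_algHom_apply, map_zero] at this
    exact this
  let S := hfin.toFinset
  let z : A := ∏ x ∈ S.offDiag, (x.1 - x.2)
  have hz : z ≠ 0 := by
    apply Finset.prod_ne_zero_iff.mpr
    intro x hx
    exact sub_ne_zero.mpr (Finset.mem_offDiag.mp hx).2.2
  obtain ⟨c, hc0, hzc⟩ := (Algebra.IsIntegral.isIntegral (R := 𝓞 K) z).isAlgebraic.exists_nonzero_dvd
    (mem_nonZeroDivisors_of_ne_zero hz)
  have hD : ∀ (p : PrimeIdeal K) (m : ℕ), c ∉ p.1 ^ m → ∀ a a',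
      (∀ j < m, ξ (p.toIK ^ j * a) = ξ (p.toIK ^ j * a')) →
      ξ (p.toIK ^ m * a) = ξ (p.toIK ^ m * a') := by
    intro p m hcm a a' h
    by_contra hne
    apply hcm
    obtain ⟨π, s, hπ, hπ0, hs, hd⟩ := exists_pi_s p
    have h1 := main_congr (A := A) p π s hπ0 hd m ξ (Set.mem_iInter.mp hξ m) a a' h
    refine mem_pow_of_dvd (A := A) F p π s hπ hπ0 hs m c (h1.trans ?_)
    rw [map_mul]
    apply mul_dvd_mul_left
    refine dvd_trans ?_ hzc
    exact Finset.dvd_prod_of_mem (fun x : A × A => x.1 - x.2)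
      (a := (ξ (p.toIK ^ m * a), ξ (p.toIK ^ m * a'))) (Finset.mem_offDiag.mpr
        ⟨hfin.mem_toFinset.mpr ⟨_, rfl⟩, hfin.mem_toFinset.mpr ⟨_, rfl⟩, hne⟩)
  have hex : ∀ p : PrimeIdeal K, ∃ m, c ∉ p.1 ^ m := by
    intro p
    by_contra! hcon
    have h1 : c ∈ ⨅ i, p.1 ^ i := (Submodule.mem_iInf _).mpr hcon
    rw [Ideal.iInf_pow_eq_bot_of_isDomain _ p.2.1.ne_top] at h1
    exact hc0 h1
  have hTfin : {p : PrimeIdeal K | c ∈ p.1}.Finite := by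
    have h1 := Ideal.finite_factors (R := 𝓞 K) (I := Ideal.span {c}) (by simpa using hc0)
    have h2 := h1.image (fun v => v.asIdeal)
    refine Set.Finite.of_finite_image (f := Subtype.val) (h2.subset ?_) Subtype.val_injective.injOn
    rintro _ ⟨p, hp, rfl⟩
    exact ⟨⟨p.1, p.2.1, p.2.2⟩, by simpa [Ideal.dvd_span_singleton] using hp, rfl⟩
  let m : PrimeIdeal K → ℕ := fun p => Nat.find (hex p)
  refine orbit_finite ξ hfin hTfin.toFinset m ?_ ?_ (fun p => hD p _ (Nat.find_spec (hex p)))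
  · intro p hp
    have hcp : c ∉ p.1 := by simpa using hp
    refine (Nat.find_eq_iff _).mpr ⟨by simpa using hcp, ?_⟩
    intro n hn
    obtain rfl : n = 0 := by omega
    simp
  · intro p
    rw [Nat.find_pos]
    simp

end helpers

/-- if `ξ ∈ W_{O_K}(O_K̄)` is integral over `O_K`, then the
`O_K`-subalgebra `O_K⟨ξ⟩` generated by the orbit `{ψ_a ξ : a ∈ I_K}` is finitely
generated as an `O_K`-module, and `K ⊗_{O_K} O_K⟨ξ⟩` is finite-dimensional over `K`
and reduced (hence finite étale over `K`). -/
theorem adjoin_orbit_finite_etale (K : Type) [Field K] [NumberField K]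
    (ξ : IK K → ↥(integralClosure (𝓞 K) (AlgebraicClosure K)))
    (hξ : ξ ∈ WittSet K ↥(integralClosure (𝓞 K) (AlgebraicClosure K)))
    (hint : IsIntegral (𝓞 K) ξ) :
    Module.Finite (𝓞 K) ↥(adjoinOrbit K ξ) ∧
    FiniteDimensional K (TensorProduct (𝓞 K) K ↥(adjoinOrbit K ξ)) ∧
    IsReduced (TensorProduct (𝓞 K) K ↥(adjoinOrbit K ξ)) := by
  have hfaith : FaithfulSMul (𝓞 K) ↥(integralClosure (𝓞 K) (AlgebraicClosure K)) := by
    rw [faithfulSMul_iff_algebraMap_injective]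
    intro x y hxy
    apply FaithfulSMul.algebraMap_injective (𝓞 K) (AlgebraicClosure K)
    exact congrArg Subtype.val hxy
  have hfin := witt_orbit_finite (AlgebraicClosure K) ξ hξ hint
  have hmod : Module.Finite (𝓞 K) ↥(adjoinOrbit K ξ) := by
    refine Module.Finite.iff_fg (N := Subalgebra.toSubmodule (adjoinOrbit K ξ)) |>.mpr ?_
    apply fg_adjoin_of_finite hfin
    rintro _ ⟨a, rfl⟩
    let φ : (IK K → ↥(integralClosure (𝓞 K) (AlgebraicClosure K))) →ₐ[𝓞 K]
        (IK K → ↥(integralClosure (𝓞 K) (AlgebraicClosure K))) :=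
      { toFun := shift a, map_one' := rfl, map_mul' := fun _ _ => rfl, map_zero' := rfl,
        map_add' := fun _ _ => rfl, commutes' := fun _ => rfl }
    exact hint.map φ
  have hred : IsReduced ↥(adjoinOrbit K ξ) :=
    isReduced_of_injective (adjoinOrbit K ξ).val Subtype.val_injective
  exact ⟨hmod, Module.Finite.base_change _ _ _, reduced_tensor _⟩

end
end
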